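/- Let R be an undecidable ceer (the set {(x,y) : R x y} is not computable) all of whose equivalence classes are finite sets. Then R is not bi-reducible with the word problem of any c.e. group: for every ceer E that is a congruence for computable operations m (binary) and i (unary) on ℕ and an element e ∈ ℕ such that the quotient modulo E is a group (m associative modulo E, [e] a two-sided identity, i giving inverses), it is not the case that R ≤ E and E ≤ R. Hence the class of groups is not ≡-complete for the ceers. -/

import Mathlib

/-- A relation on ℕ is computably enumerable (as a set of pairs). -/
def CeRel (E : ℕ → ℕ → Prop) : Prop :=
  Partrec fun p : ℕ × ℕ => Part.assert (E p.1 p.2) fun _ => Part.some 0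

/-- A ceer: a computably enumerable equivalence relation on ℕ. -/
def Ceer (E : ℕ → ℕ → Prop) : Prop := Equivalence E ∧ CeRel E

/-- `E` is a congruence with respect to the binary operation `m` on ℕ. -/
def CeerCongruence (E : ℕ → ℕ → Prop) (m : ℕ → ℕ → ℕ) : Prop :=
  ∀ a a' b b', E a a' → E b b' → E (m a b) (m a' b')

/-- `R` is (computably) reducible to `S`. -/
def CeerReduces (R S : ℕ → ℕ → Prop) : Prop :=
  ∃ g : ℕ → ℕ, Computable g ∧ ∀ x y, R x y ↔ S (g x) (g y)

/-- A finite set is decidable. -/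
theorem Set.Finite.computablePred_mem {α : Type*} [Primcodable α] {s : Set α} (hs : s.Finite) :
    ComputablePred fun a => a ∈ s := by
  have h : PrimrecPred fun a => ∃ b ∈ hs.toFinset.toList, b = a :=
    Primrec.eq.exists_mem_list.comp (Primrec.const hs.toFinset.toList) Primrec.id
  exact PrimrecPred.computablePred (h.of_eq fun a => by simp)

/-- In a group presented as a quotient of ℕ, two elements `x`, `y` are equal exactly when
`x * y⁻¹` is the identity. -/
theorem CeerCongruence.rel_iff_mul_inv_rel_one {E : ℕ → ℕ → Prop} {m : ℕ → ℕ → ℕ} {i : ℕ → ℕ}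
    {e : ℕ} (hE : Equivalence E) (hm : CeerCongruence E m)
    (assoc : ∀ a b c, E (m (m a b) c) (m a (m b c)))
    (mul_one : ∀ x, E (m x e) x) (one_mul : ∀ x, E (m e x) x)
    (mul_inv : ∀ x, E (m x (i x)) e) (inv_mul : ∀ x, E (m (i x) x) e) (x y : ℕ) :
    E x y ↔ E (m x (i y)) e := by
  refine ⟨fun h => hE.trans (hm _ _ _ _ h (hE.refl _)) (mul_inv y), fun h => ?_⟩
  have h₁ : E x (m x (m (i y) y)) :=
    hE.trans (hE.symm (mul_one x)) (hm _ _ _ _ (hE.refl x) (hE.symm (inv_mul y)))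
  have h₂ : E (m (m x (i y)) y) y := hE.trans (hm _ _ _ _ h (hE.refl y)) (one_mul y)
  exact hE.trans h₁ (hE.trans (hE.symm (assoc x (i y) y)) h₂)

/-- An undecidable ceer all of whose classes are finite is not bi-reducible with the
word problem of any c.e. group; hence the class of groups is not ≡-complete for the ceers. -/
theorem stmt_9 (R : ℕ → ℕ → Prop) (hR : Ceer R)
    (hundec : ¬ ComputablePred fun p : ℕ × ℕ => R p.1 p.2)
    (hfin : ∀ x, {y | R y x}.Finite) :
    ∀ (E : ℕ → ℕ → Prop) (m : ℕ → ℕ → ℕ) (i : ℕ → ℕ) (e : ℕ),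
      Ceer E → Computable₂ m → Computable i →
      CeerCongruence E m → (∀ a a', E a a' → E (i a) (i a')) →
      (∀ a b c, E (m (m a b) c) (m a (m b c))) →
      (∀ x, E (m x e) x) → (∀ x, E (m e x) x) →
      (∀ x, E (m x (i x)) e) → (∀ x, E (m (i x) x) e) →
      ¬ (CeerReduces R E ∧ CeerReduces E R) := by
  rintro E m i e ⟨hE, -⟩ hm hi hcong - assoc mul_one one_mul mul_inv inv_mul
    ⟨⟨f, hf, hRE⟩, g, hg, hER⟩
  refine hundec (ComputablePred.computable_of_manyOneReducible
    (q := fun a => a ∈ {y | R y (g e)})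
    ⟨fun p => g (m (f p.1) (i (f p.2))), ?_, fun p => ?_⟩ (hfin (g e)).computablePred_mem)
  · exact hg.comp (hm.comp (hf.comp Computable.fst) (hi.comp (hf.comp Computable.snd)))
  · exact (hRE _ _).trans ((hcong.rel_iff_mul_inv_rel_one hE assoc mul_one one_mul mul_inv
      inv_mul _ _).trans (hER _ _))
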